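/- For 1 ≤ i ≤ m−1 write P_i := {1,…,i} and let D_{P_i} be the subgroup of G generated by j together with τ_{i+1}, …, τ_{m−1}. Then for every i with 1 ≤ i ≤ m−2 and every k ≥ 1 there is an isomorphism of group cohomology H^k(D_{P_{i+1}}, Λ/Λ(P_{i+1})) ≅ H^{k+1}(D_{P_i}, Λ/Λ(P_i)), where in each case the subgroup acts on the quotient of Λ by left multiplication. -/

import Mathlib

set_option maxHeartbeats 1000000

/-- The norm element `s(H) = Σ_{h ∈ H} h` of a subgroup `H`, in the integral group ring. -/
noncomputable def sElt {G : Type} [Group G] [Finite G] (H : Subgroup G) :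
    MonoidAlgebra ℤ G :=
  letI : Fintype H := Fintype.ofFinite _
  ∑ h : H, MonoidAlgebra.of ℤ G (h : G)

/-- The representation of a subgroup `D ≤ G` on the quotient of `ℤ[G]` by an ideal `I`,
where `D` acts by left multiplication. -/
noncomputable def quotRep {G : Type} [CommGroup G] (I : Ideal (MonoidAlgebra ℤ G))
    (D : Subgroup G) : Representation ℤ D (MonoidAlgebra ℤ G ⧸ I) :=
  (((Algebra.lmul ℤ (MonoidAlgebra ℤ G ⧸ I)).toRingHom.toMonoidHom).comp
    ((Ideal.Quotient.mk I).toMonoidHom)).comp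
    ((MonoidAlgebra.of ℤ G).comp D.subtype)

section Coinduction

open CategoryTheory Limits

variable {k G V : Type} [CommRing k] [CommGroup G] [AddCommGroup V] [Module k V]

/-- A linear endomorphism `φ` of a representation is an `N`-decomposing projection if `V` is the
internal direct sum of the translates by `N` of the range of `φ`, with `φ` the projection onto the
summand indexed by `1`. -/
structure IsDecomposingProjection (ρ : Representation k G V) (N : Subgroup G) [Fintype N]
    (φ : V →ₗ[k] V) : Prop where
  sum_eq : ∀ x, ∑ n : N, ρ n (φ (ρ (n : G)⁻¹ x)) = x
  orthogonal : ∀ n ∈ N, n ≠ 1 → ∀ x, φ (ρ n (φ x)) = 0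

namespace IsDecomposingProjection

variable {ρ : Representation k G V} {N : Subgroup G} [Fintype N] {φ : V →ₗ[k] V}

lemma idempotent (h : IsDecomposingProjection ρ N φ) (x : V) : φ (φ x) = φ x := by
  have := h.sum_eq (φ x)
  rw [Finset.sum_eq_single 1] at this
  · simpa using this
  · intro n _ hn
    rw [h.orthogonal _ (inv_mem n.2) (by simpa using hn)]
    simp
  · simp

/-- The trace over `N` of `φ`, as a map into the `N`-invariants. -/
noncomputable def trace (_h : IsDecomposingProjection ρ N φ) :
    V →ₗ[k] Representation.invariants (ρ.comp N.subtype) :=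
  LinearMap.codRestrict _ (∑ n : N, ρ n ∘ₗ φ) fun x n => by
    simp only [LinearMap.sum_apply, map_sum, LinearMap.comp_apply, MonoidHom.comp_apply,
      Subgroup.subtype_apply]
    exact Fintype.sum_equiv (Equiv.mulLeft n) _ _ fun m => by simp

lemma coe_trace (h : IsDecomposingProjection ρ N φ) (x : V) :
    (h.trace x : V) = ∑ n : N, ρ n (φ x) :=
  LinearMap.sum_apply _ _ _

lemma trace_coe (h : IsDecomposingProjection ρ N φ)
    (x : Representation.invariants (ρ.comp N.subtype)) :
    h.trace x = x := by
  ext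
  rw [coe_trace]
  conv_rhs => rw [← h.sum_eq x]
  refine Finset.sum_congr rfl fun n _ => ?_
  rw [show ρ (n : G)⁻¹ (x : V) = x from x.2 n⁻¹]

lemma apply_trace (h : IsDecomposingProjection ρ N φ) (x : V) : φ (h.trace x) = φ x := by
  rw [coe_trace, map_sum, Finset.sum_eq_single 1]
  · simpa using h.idempotent x
  · exact fun n _ hn => h.orthogonal _ n.2 (by simpa using hn) x
  · simp

lemma trace_apply (h : IsDecomposingProjection ρ N φ) (x : V) : h.trace (φ x) = h.trace x := by
  ext
  simp only [coe_trace, h.idempotent]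

lemma trace_orthogonal (h : IsDecomposingProjection ρ N φ) {n : G} (hn : n ∈ N) (hn1 : n ≠ 1)
    (x : V) : h.trace (ρ n (φ x)) = 0 := by
  ext
  simp [coe_trace, h.orthogonal n hn hn1]

lemma sum_trace (h : IsDecomposingProjection ρ N φ) (x : V) :
    ∑ n : N, ρ (n : G)⁻¹ (φ (h.trace (ρ n x))) = x := by
  simp only [apply_trace]
  conv_rhs => rw [← h.sum_eq x]
  exact Fintype.sum_equiv (Equiv.inv N) _ _ fun n => by simp

lemma trace_comm (h : IsDecomposingProjection ρ N φ) {s : G} (hs : ∀ x, φ (ρ s x) = ρ s (φ x))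
    (x : V) : h.trace (ρ s x) = ρ.toInvariants N s (h.trace x) := by
  ext
  simp only [Representation.subrepresentation_apply, LinearMap.coe_restrict_apply, coe_trace,
    map_sum, hs]
  refine Finset.sum_congr rfl fun n _ => ?_
  rw [← Module.End.mul_apply, ← Module.End.mul_apply (ρ s) (ρ n), ← map_mul, ← map_mul, mul_comm]

/-- If `D` is the product of `N` and `S`, and `φ` is `S`-equivariant, then `V` is coinduced from
the action of `S` on the `N`-invariants. -/
lemma nonempty_iso_coind (h : IsDecomposingProjection ρ N φ) {D S : Subgroup G}
    (hD : S ⊔ N = D) (hS : ∀ s ∈ S, ∀ x, φ (ρ s x) = ρ s (φ x)) :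
    Nonempty (Rep.of (ρ.comp D.subtype) ≅ Rep.coind (S.subgroupOf D).subtype
      (Rep.of (((ρ.toInvariants N).comp D.subtype).comp (S.subgroupOf D).subtype))) := by
  have hND : N ≤ D := hD ▸ le_sup_right
  let σ := ((ρ.toInvariants N).comp D.subtype).comp (S.subgroupOf D).subtype
  let F : V →ₗ[k] Representation.coindV (S.subgroupOf D).subtype σ :=
    LinearMap.codRestrict _ (LinearMap.pi fun d : D => h.trace ∘ₗ ρ d) fun x s d => by
      simp only [LinearMap.pi_apply, LinearMap.comp_apply, Subgroup.subtype_apply,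
        Subgroup.coe_mul, map_mul, Module.End.mul_apply]
      exact h.trace_comm (hS _ s.2) _
  have hsmul (f : Representation.coindV (S.subgroupOf D).subtype σ) (s : S.subgroupOf D) (d : D) :
      f.1 ((s : D) * d) = σ s (f.1 d) := f.2 s d
  have hF (x : V) (d : D) : (F x).1 d = h.trace (ρ d x) := rfl
  have hinj : Function.Injective F := by
    rw [injective_iff_map_eq_zero]
    intro x hx
    rw [← h.sum_trace x]
    refine Finset.sum_eq_zero fun n _ => ?_
    rw [← hF x ⟨n, hND n.2⟩, hx]
    simp
  have hsurj : Function.Surjective F := by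
    intro f
    refine ⟨∑ n : N, ρ (n : G)⁻¹ (φ (f.1 ⟨n, hND n.2⟩)), Subtype.ext (funext fun d => ?_)⟩
    obtain ⟨s, hs, n₀, hn₀, hd⟩ := Subgroup.mem_sup.1 (hD ▸ d.2 : (d : G) ∈ S ⊔ N)
    have hd' : d = ((⟨⟨s, hD ▸ Subgroup.mem_sup_left hs⟩, hs⟩ : S.subgroupOf D) : D) *
        ⟨n₀, hND hn₀⟩ := Subtype.ext hd.symm
    rw [hd', hsmul, hsmul]
    congr 1
    rw [hF, map_sum, map_sum, Finset.sum_eq_single ⟨n₀, hn₀⟩]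
    · simp [trace_apply, trace_coe]
    · intro n _ hn
      rw [← Module.End.mul_apply, ← map_mul]
      refine h.trace_orthogonal (mul_mem hn₀ (inv_mem n.2)) (fun h1 => hn ?_) _
      exact Subtype.ext (mul_inv_eq_one.1 h1).symm
    · simp
  refine ⟨Rep.mkIso (.mk (LinearEquiv.ofBijective F ⟨hinj, hsurj⟩) fun d => ?_)⟩
  refine LinearMap.ext fun x => Subtype.ext (funext fun e => ?_)
  change h.trace (ρ e (ρ d x)) = h.trace (ρ ((e * d : D) : G) x)
  simp

lemma nonempty_groupCohomology_iso (h : IsDecomposingProjection ρ N φ) {D S : Subgroup G}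
    (hD : S ⊔ N = D) (hS : ∀ s ∈ S, ∀ x, φ (ρ s x) = ρ s (φ x)) (n : ℕ) :
    Nonempty (groupCohomology (Rep.of (ρ.comp D.subtype)) n ≅ groupCohomology
      (Rep.of (((ρ.toInvariants N).comp D.subtype).comp (S.subgroupOf D).subtype)) n) := by
  obtain ⟨e⟩ := h.nonempty_iso_coind hD hS
  exact ⟨(groupCohomology.functor k D n).mapIso e ≪≫ groupCohomology.coindIso _ n⟩

lemma isZero_groupCohomology_succ (h : IsDecomposingProjection ρ N φ) (n : ℕ) :
    IsZero (groupCohomology (Rep.of (ρ.comp N.subtype)) (n + 1)) := by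
  obtain ⟨e⟩ := h.nonempty_groupCohomology_iso (S := ⊥) (bot_sup_eq N) (by simp) (n + 1)
  have : Subsingleton ((⊥ : Subgroup G).subgroupOf N) := by
    rw [Subgroup.bot_subgroupOf]
    infer_instance
  exact (isZero_groupCohomology_succ_of_subsingleton _ n).of_iso e

end IsDecomposingProjection

/-- If `p` is a homomorphism with kernel `N`, injective on `D'`, and `D = D' N`, then `D` and `D'`
have isomorphic cohomology when `V` decomposes along `N` compatibly with `p(D')`. -/
lemma nonempty_groupCohomology_iso_of_projection {ρ : Representation k G V} {p : G →* G}
    [Fintype p.ker] {φ : V →ₗ[k] V} (h : IsDecomposingProjection ρ p.ker φ)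
    (hp : ∀ x, p (p x) = p x) {D D' : Subgroup G} (hD : D' ⊔ p.ker = D) (hD' : D' ⊓ p.ker = ⊥)
    (hφ : ∀ s, p s = s → ∀ x, φ (ρ s x) = ρ s (φ x)) (n : ℕ) :
    Nonempty (groupCohomology (Rep.of (ρ.comp D.subtype)) n ≅ groupCohomology
      (Rep.of ((ρ.toInvariants p.ker).comp D'.subtype)) n) := by
  have hker (x : G) : x⁻¹ * p x ∈ p.ker := by simp [MonoidHom.mem_ker, hp]
  have hmem {x : G} (hx : x ∈ D') : p x ∈ D := by
    rw [← hD, ← mul_inv_cancel_left x (p x)]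
    exact Subgroup.mul_mem_sup hx (hker x)
  have hsup : D'.map p ⊔ p.ker = D := by
    rw [← hD]
    refine le_antisymm (sup_le ?_ le_sup_right) (sup_le (fun x hx => ?_) le_sup_right)
    · rintro _ ⟨x, hx, rfl⟩
      exact hD ▸ hmem hx
    · rw [← mul_inv_cancel_left (p x) x]
      refine Subgroup.mul_mem_sup ⟨x, hx, rfl⟩ ?_
      simp [MonoidHom.mem_ker, hp]
  obtain ⟨i⟩ := h.nonempty_groupCohomology_iso hsup
    (by rintro _ ⟨x, -, rfl⟩; exact hφ _ (hp x)) n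
  let θ : D' →* (D'.map p).subgroupOf D :=
    ((p.comp D'.subtype).codRestrict D fun x => hmem x.2).codRestrict _ fun x => ⟨x, x.2, rfl⟩
  have hθ (x : D') : ((θ x : D) : G) = p x := rfl
  have hbij : Function.Bijective θ := by
    constructor
    · rw [injective_iff_map_eq_one]
      intro x hx
      have : (x : G) ∈ D' ⊓ p.ker := ⟨x.2, MonoidHom.mem_ker.2 (by rw [← hθ, hx]; rfl)⟩
      rw [hD'] at this
      exact Subtype.ext this
    · rintro ⟨y, x, hx, hxy⟩
      exact ⟨⟨x, hx⟩, Subtype.ext (Subtype.ext hxy)⟩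
  refine ⟨i ≪≫ (groupCohomology.mapIso (MulEquiv.ofBijective θ hbij) (LinearEquiv.refl k _)
    (fun d => ?_) n).symm⟩
  ext x
  change ρ d x = ρ (p d) x
  have hx : ρ ((d : G)⁻¹ * p d) (x : V) = x := x.2 ⟨_, hker d⟩
  conv_lhs => rw [← hx]
  simp [← Module.End.mul_apply, ← map_mul]

end Coinduction

section GroupRing

open CategoryTheory Limits

variable {G : Type} [CommGroup G]

lemma sElt_eq_sum [Finite G] (H : Subgroup G) [Fintype H] :
    sElt H = ∑ h : H, MonoidAlgebra.of ℤ G h := by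
  unfold sElt
  congr!

/-- The action of `G` on a quotient of `ℤ[G]` by multiplication. -/
noncomputable def ambientQuotRep (I : Ideal (MonoidAlgebra ℤ G)) :
    Representation ℤ G (MonoidAlgebra ℤ G ⧸ I) :=
  (((Algebra.lmul ℤ (MonoidAlgebra ℤ G ⧸ I)).toRingHom.toMonoidHom).comp
    ((Ideal.Quotient.mk I).toMonoidHom)).comp (MonoidAlgebra.of ℤ G)

lemma quotRep_eq (I : Ideal (MonoidAlgebra ℤ G)) (D : Subgroup G) :
    quotRep I D = (ambientQuotRep I).comp D.subtype := rfl

lemma ambientQuotRep_apply (I : Ideal (MonoidAlgebra ℤ G)) (g : G) (x : MonoidAlgebra ℤ G ⧸ I) :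
    ambientQuotRep I g x = Ideal.Quotient.mk I (MonoidAlgebra.of ℤ G g) * x := rfl

open Classical in
/-- The linear endomorphism of `ℤ[G]` that keeps the group elements in `T` and kills the others. -/
noncomputable def truncate (T : Set G) : MonoidAlgebra ℤ G →ₗ[ℤ] MonoidAlgebra ℤ G :=
  Finsupp.linearCombination ℤ (fun g => if g ∈ T then MonoidAlgebra.of ℤ G g else 0) ∘ₗ
    (MonoidAlgebra.coeffLinearEquiv ℤ).toLinearMap

open Classical in
lemma truncate_of (T : Set G) (g : G) :
    truncate T (MonoidAlgebra.of ℤ G g) = if g ∈ T then MonoidAlgebra.of ℤ G g else 0 := by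
  simp [truncate, MonoidAlgebra.of_apply]

lemma groupRing_linearMap_ext {M : Type} [AddCommGroup M] {f f' : MonoidAlgebra ℤ G →ₗ[ℤ] M}
    (h : ∀ g, f (MonoidAlgebra.of ℤ G g) = f' (MonoidAlgebra.of ℤ G g)) : f = f' := by
  ext g
  simpa using h g

lemma truncate_of_mul {T : Set G} {h : G} (hT : ∀ g, h * g ∈ T ↔ g ∈ T)
    (x : MonoidAlgebra ℤ G) :
    truncate T (MonoidAlgebra.of ℤ G h * x) = MonoidAlgebra.of ℤ G h * truncate T x := by
  have : truncate T ∘ₗ LinearMap.mulLeft ℤ (MonoidAlgebra.of ℤ G h) =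
      LinearMap.mulLeft ℤ (MonoidAlgebra.of ℤ G h) ∘ₗ truncate T := by
    refine groupRing_linearMap_ext fun g => ?_
    simp only [LinearMap.comp_apply, LinearMap.mulLeft_apply, ← map_mul, truncate_of]
    by_cases hg : g ∈ T
    · rw [if_pos hg, if_pos ((hT g).2 hg), map_mul]
    · rw [if_neg hg, if_neg (mt (hT g).1 hg), mul_zero]
  exact LinearMap.congr_fun this x

lemma truncate_sElt_mul [Finite G] {T : Set G} {H : Subgroup G}
    (hT : ∀ h ∈ H, ∀ g, h * g ∈ T ↔ g ∈ T) (x : MonoidAlgebra ℤ G) :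
    truncate T (sElt H * x) = sElt H * truncate T x := by
  have := Fintype.ofFinite H
  simp only [sElt_eq_sum, Finset.sum_mul, map_sum]
  exact Finset.sum_congr rfl fun h _ => truncate_of_mul (hT h h.2) x

lemma truncate_mem_span [Finite G] {T : Set G} {𝓗 : Set (Subgroup G)}
    (hT : ∀ H ∈ 𝓗, ∀ h ∈ H, ∀ g, h * g ∈ T ↔ g ∈ T) {x : MonoidAlgebra ℤ G}
    (hx : x ∈ Ideal.span (sElt '' 𝓗)) : truncate T x ∈ Ideal.span (sElt '' 𝓗) := by
  suffices ∀ a, truncate T (a * x) ∈ Ideal.span (sElt '' 𝓗) by simpa using this 1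
  induction hx using Submodule.span_induction with
  | mem x hx =>
    obtain ⟨H, hH, rfl⟩ := hx
    intro a
    rw [mul_comm, truncate_sElt_mul (hT H hH)]
    exact Ideal.mul_mem_right _ _ (Ideal.subset_span ⟨H, hH, rfl⟩)
  | zero => simp
  | add x y _ _ hx hy =>
    intro a
    rw [mul_add, map_add]
    exact add_mem (hx a) (hy a)
  | smul b x _ hx =>
    intro a
    rw [smul_eq_mul, ← mul_assoc]
    exact hx _

/-- If the translates by `N` of the set `T` partition `G`, and `T` is stable under the subgroups
whose norm elements generate `I`, then `ℤ[G] ⧸ I` decomposes along `N`. -/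
lemma exists_isDecomposingProjection [Finite G] {T : Set G} {𝓗 : Set (Subgroup G)}
    {I : Ideal (MonoidAlgebra ℤ G)} (hI : I = Ideal.span (sElt '' 𝓗))
    (hT : ∀ H ∈ 𝓗, ∀ h ∈ H, ∀ g, h * g ∈ T ↔ g ∈ T) (N : Subgroup G) [Fintype N]
    (hN : ∀ g, ∃! n : N, (n : G)⁻¹ * g ∈ T) :
    ∃ φ, IsDecomposingProjection (ambientQuotRep I) N φ ∧
      ∀ s, (∀ g, s * g ∈ T ↔ g ∈ T) → ∀ x,
        φ (ambientQuotRep I s x) = ambientQuotRep I s (φ x) := by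
  classical
  let φ : (MonoidAlgebra ℤ G ⧸ I) →ₗ[ℤ] (MonoidAlgebra ℤ G ⧸ I) :=
    (QuotientAddGroup.map I.toAddSubgroup I.toAddSubgroup (truncate T).toAddMonoidHom
      fun x hx => by
        subst hI
        exact truncate_mem_span hT hx).toIntLinearMap
  have hφ (x : MonoidAlgebra ℤ G) :
      φ (Ideal.Quotient.mk I x) = Ideal.Quotient.mk I (truncate T x) := rfl
  refine ⟨φ, ⟨fun x => ?_, fun n hn hn1 x => ?_⟩, fun s hs x => ?_⟩ <;>
    obtain ⟨x, rfl⟩ := Ideal.Quotient.mk_surjective x <;>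
    simp only [ambientQuotRep_apply, ← map_mul (Ideal.Quotient.mk I), hφ, ← map_sum]
  · congr 1
    have : ∑ n : N, LinearMap.mulLeft ℤ (MonoidAlgebra.of ℤ G n) ∘ₗ truncate T ∘ₗ
        LinearMap.mulLeft ℤ (MonoidAlgebra.of ℤ G (n : G)⁻¹) = LinearMap.id := by
      refine groupRing_linearMap_ext fun g => ?_
      obtain ⟨n, hn, huniq⟩ := hN g
      simp only [LinearMap.sum_apply, LinearMap.comp_apply, LinearMap.mulLeft_apply, ← map_mul,
        truncate_of, LinearMap.id_apply]
      rw [Finset.sum_eq_single n]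
      · rw [if_pos hn, ← map_mul, mul_inv_cancel_left]
      · intro n' _ hn'
        rw [if_neg fun h => hn' (huniq n' h), mul_zero]
      · simp
    simpa [LinearMap.sum_apply] using LinearMap.congr_fun this x
  · have : truncate T ∘ₗ LinearMap.mulLeft ℤ (MonoidAlgebra.of ℤ G n) ∘ₗ truncate T = 0 := by
      refine groupRing_linearMap_ext fun g => ?_
      simp only [LinearMap.comp_apply, truncate_of]
      split_ifs with hg
      · rw [LinearMap.mulLeft_apply, ← map_mul, truncate_of, if_neg, LinearMap.zero_apply]
        intro h
        refine hn1 ?_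
        have := (hN (n * g)).unique (y₁ := 1) (y₂ := ⟨n, hn⟩) (by simpa using h) (by simpa using hg)
        exact (congrArg Subtype.val this).symm
      · simp
    rw [show truncate T (MonoidAlgebra.of ℤ G n * truncate T x) = 0 from
      LinearMap.congr_fun this x, map_zero]
  · rw [truncate_of_mul hs]

/-- A subgroup `D` meeting `H` trivially has an `H`-stable set of coset representatives. -/
lemma exists_stable_transversal {H D : Subgroup G} (hHD : H ⊓ D = ⊥) :
    ∃ T : Set G, (∀ h ∈ H, ∀ g, h * g ∈ T ↔ g ∈ T) ∧ ∀ g, ∃! d : D, (d : G)⁻¹ * g ∈ T := by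
  let r (g : G) : G := (QuotientGroup.mk g : G ⧸ (H ⊔ D)).out
  have hr {g g' : G} (h : g⁻¹ * g' ∈ H ⊔ D) : r g = r g' := by
    simp only [r, QuotientGroup.eq.2 h]
  refine ⟨{g | g * (r g)⁻¹ ∈ H}, fun h hh g => ?_, fun g => ?_⟩
  · have : r (h * g) = r g := hr <| by
      simpa [mul_comm] using Subgroup.mem_sup_left (T := D) (inv_mem hh)
    simp only [Set.mem_ofPred_eq, this, mul_assoc]
    exact Subgroup.mul_mem_cancel_left H hh
  · have hrd (d : D) : r ((d : G)⁻¹ * g) = r g := hr <| by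
      simpa [mul_comm] using Subgroup.mem_sup_right (S := H) d.2
    simp only [Set.mem_ofPred_eq, hrd]
    have hg : g * (r g)⁻¹ ∈ H ⊔ D := by
      rw [mul_comm]
      exact QuotientGroup.eq.1 (QuotientGroup.out_eq' (g : G ⧸ (H ⊔ D)))
    obtain ⟨h, hh, d, hd, hhd⟩ := Subgroup.mem_sup.1 hg
    refine ⟨⟨d, hd⟩, ?_, fun d' hd' => ?_⟩
    · have : d⁻¹ * g * (r g)⁻¹ = h := by
        rw [mul_assoc, ← hhd, mul_comm h d, inv_mul_cancel_left]
      rwa [← this] at hh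
    · have hmem : (d' : G)⁻¹ * d ∈ H ⊓ D := by
        refine Subgroup.mem_inf.2 ⟨?_, mul_mem (inv_mem d'.2) hd⟩
        have := mul_mem hd' (inv_mem hh)
        rw [mul_assoc, mul_assoc, ← mul_assoc g, ← hhd] at this
        simpa [mul_comm, mul_assoc] using this
      rw [hHD, Subgroup.mem_bot] at hmem
      exact Subtype.ext (inv_mul_eq_one.1 hmem)

/-- The invariants of `ker p` in `ℤ[G] ⧸ I` are the kernel of the map to `ℤ[G] ⧸ J`, where `J` is
obtained from `I` by adding the norm element of `ker p`. -/
lemma mem_invariants_iff_factor_eq_zero [Finite G] {I J : Ideal (MonoidAlgebra ℤ G)}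
    {N : Subgroup G} [Fintype N] (hJ : J = I ⊔ Ideal.span {sElt N}) (hIJ : I ≤ J)
    {φ} (h : IsDecomposingProjection (ambientQuotRep I) N φ) (x : MonoidAlgebra ℤ G ⧸ I) :
    x ∈ Representation.invariants ((ambientQuotRep I).comp N.subtype) ↔
      Ideal.Quotient.factor hIJ x = 0 := by
  have hs : sElt N ∈ J := hJ ▸ Ideal.mem_sup_right (Ideal.mem_span_singleton_self _)
  constructor
  · intro hx
    have : x = Ideal.Quotient.mk I (sElt N) * φ x := by
      conv_lhs => rw [← show (h.trace x : MonoidAlgebra ℤ G ⧸ I) = x from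
        congrArg Subtype.val (h.trace_coe ⟨x, hx⟩)]
      simp only [h.coe_trace, ambientQuotRep_apply, sElt_eq_sum, map_sum, Finset.sum_mul]
    rw [this, map_mul, Ideal.Quotient.factor_mk, Ideal.Quotient.eq_zero_iff_mem.2 hs, zero_mul]
  · obtain ⟨x, rfl⟩ := Ideal.Quotient.mk_surjective x
    rw [Ideal.Quotient.factor_mk, Ideal.Quotient.eq_zero_iff_mem, hJ]
    intro hx n
    obtain ⟨a, ha, b, hb, rfl⟩ := Submodule.mem_sup.1 hx
    obtain ⟨c, rfl⟩ := Ideal.mem_span_singleton.1 hb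
    have hn : MonoidAlgebra.of ℤ G n * sElt N = sElt N := by
      simp only [sElt_eq_sum, Finset.mul_sum, ← map_mul]
      exact Fintype.sum_equiv (Equiv.mulLeft n) _ _ fun m => by simp
    rw [map_add, Ideal.Quotient.eq_zero_iff_mem.2 ha, zero_add, MonoidHom.comp_apply,
      ambientQuotRep_apply, ← map_mul, Subgroup.subtype_apply, ← mul_assoc, hn]

lemma rep_shortExact {k Γ : Type} [CommRing k] [Group Γ] {X : ShortComplex (Rep.{0} k Γ)}
    (hf : Function.Injective X.f.hom) (hg : Function.Surjective X.g.hom)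
    (hfg : ∀ x, X.g.hom x = 0 → ∃ y, X.f.hom y = x) : X.ShortExact where
  exact := (forget₂ (Rep.{0} k Γ) (ModuleCat k)).reflects_exact_of_faithful _ <|
    (ShortComplex.moduleCat_exact_iff _).2 hfg
  mono_f := (Rep.mono_iff_injective _).2 hf
  epi_g := (Rep.epi_iff_surjective _).2 hg

/-- The connecting isomorphism for `0 → (ℤ[G] ⧸ I)^N → ℤ[G] ⧸ I → ℤ[G] ⧸ J → 0` when the middle
term has no cohomology. -/
lemma nonempty_groupCohomology_iso_invariants [Finite G] {I J : Ideal (MonoidAlgebra ℤ G)}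
    {N : Subgroup G} [Fintype N] (hJ : J = I ⊔ Ideal.span {sElt N})
    {φ} (h : IsDecomposingProjection (ambientQuotRep I) N φ) (D : Subgroup G)
    (hz : ∀ n, IsZero (groupCohomology (Rep.of ((ambientQuotRep I).comp D.subtype)) (n + 1)))
    (n : ℕ) :
    Nonempty (groupCohomology (Rep.of ((ambientQuotRep J).comp D.subtype)) (n + 1) ≅
      groupCohomology (Rep.of (((ambientQuotRep I).toInvariants N).comp D.subtype)) (n + 2)) := by
  have hIJ : I ≤ J := hJ ▸ le_sup_left
  have hker := mem_invariants_iff_factor_eq_zero hJ hIJ h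
  let i : Rep.of (((ambientQuotRep I).toInvariants N).comp D.subtype) ⟶
      Rep.of ((ambientQuotRep I).comp D.subtype) :=
    Rep.ofHom ⟨Submodule.subtype _, fun _ => rfl⟩
  let q : Rep.of ((ambientQuotRep I).comp D.subtype) ⟶
      Rep.of ((ambientQuotRep J).comp D.subtype) :=
    Rep.ofHom ⟨(Ideal.Quotient.factor hIJ).toAddMonoidHom.toIntLinearMap, fun d =>
      LinearMap.ext fun x => map_mul (Ideal.Quotient.factor hIJ) _ x⟩
  let X : ShortComplex (Rep.{0} ℤ D) := .mk i q (by
    ext x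
    exact (hker _).1 x.2)
  have hX : X.ShortExact := rep_shortExact (fun _ _ h => Subtype.ext h)
    (Ideal.Quotient.factor_surjective hIJ) fun x hx => ⟨⟨x, (hker x).2 hx⟩, rfl⟩
  have := groupCohomology.isIso_δ_of_isZero hX (n + 1) (hz n) (hz (n + 1))
  exact ⟨asIso (groupCohomology.δ hX (n + 1) (n + 2) rfl)⟩

/-- The dimension shift obtained by adding the norm element of the kernel of an idempotent
endomorphism `p` of `G`. -/
theorem nonempty_groupCohomology_quotRep_iso [Finite G] {p : G →* G} (hp : ∀ x, p (p x) = p x)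
    {𝓗 : Set (Subgroup G)} (h𝓗 : ∀ H ∈ 𝓗, ∀ h ∈ H, p h = h)
    {I J : Ideal (MonoidAlgebra ℤ G)} (hI : I = Ideal.span (sElt '' 𝓗))
    (hJ : J = I ⊔ Ideal.span {sElt p.ker}) {D D' : Subgroup G} (hD : D' ⊔ p.ker = D)
    (hD' : D' ⊓ p.ker = ⊥) (hHD' : sSup 𝓗 ⊓ D' = ⊥) (n : ℕ) :
    Nonempty (groupCohomology (Rep.of (quotRep J D')) (n + 1) ≅
      groupCohomology (Rep.of (quotRep I D)) (n + 2)) := by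
  have := Fintype.ofFinite p.ker
  have := Fintype.ofFinite D'
  have hstab (s : G) (hs : p s = s) (g : G) : s * g ∈ {g | p g = g} ↔ g ∈ {g | p g = g} := by
    simp [hs]
  obtain ⟨φ, hφ, hφp⟩ := exists_isDecomposingProjection (T := {g | p g = g}) hI
    (fun H hH h hh => hstab h (h𝓗 H hH h hh)) p.ker fun g => by
      refine ⟨⟨g * (p g)⁻¹, by simp [MonoidHom.mem_ker, hp]⟩, by simp [hp], fun n hn => ?_⟩
      have hn' : p n = 1 := n.2
      ext
      simp only [Set.mem_ofPred_eq, map_mul, map_inv, hn', inv_one, one_mul] at hn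
      simp [hn]
  obtain ⟨T, hT, hTD⟩ := exists_stable_transversal hHD'
  obtain ⟨ψ, hψ, -⟩ := exists_isDecomposingProjection hI
    (fun H hH h hh => hT h (le_sSup hH hh)) D' hTD
  obtain ⟨e₁⟩ := nonempty_groupCohomology_iso_invariants hJ hφ D' hψ.isZero_groupCohomology_succ n
  obtain ⟨e₂⟩ := nonempty_groupCohomology_iso_of_projection hφ hp hD hD'
    (fun s hs => hφp s (hstab s hs)) (n + 2)
  exact ⟨e₁ ≪≫ e₂.symm⟩

end GroupRing

section Coordinates

variable {ι G : Type} [CommGroup G] {τ : ι → G}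

lemma monoidHom_ext_of_iSup_zpowers (hgen : (⨆ i, Subgroup.zpowers (τ i)) = ⊤) {f f' : G →* G}
    (h : ∀ i, f (τ i) = f' (τ i)) : f = f' := by
  have : (⨆ i, Subgroup.zpowers (τ i)) ≤ f.eqLocus f' :=
    iSup_le fun i => (Subgroup.zpowers_le).2 (h i)
  rw [hgen] at this
  exact MonoidHom.ext fun x => this (Subgroup.mem_top x)

/-- The coordinate projections of an internal direct product of cyclic groups. -/
lemma exists_coordinates [Fintype ι] [DecidableEq ι]
    (hindep : iSupIndep fun i => Subgroup.zpowers (τ i))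
    (hgen : (⨆ i, Subgroup.zpowers (τ i)) = ⊤) :
    ∃ c : ι → G →* G, (∀ s t, c t (τ s) = if s = t then τ t else 1) ∧
      (∀ t x, c t x ∈ Subgroup.zpowers (τ t)) ∧ ∀ x, ∏ t, c t x = x := by
  have hcomm : Pairwise fun i j => ∀ x y : G, x ∈ Subgroup.zpowers (τ i) →
      y ∈ Subgroup.zpowers (τ j) → Commute x y := fun _ _ _ x y _ _ => mul_comm x y
  have hbij : Function.Bijective (Subgroup.noncommPiCoprod hcomm) :=
    ⟨Subgroup.injective_noncommPiCoprod_of_iSupIndep hindep, by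
      rw [← MonoidHom.range_eq_top, Subgroup.noncommPiCoprod_range, hgen]⟩
  let e := MulEquiv.ofBijective _ hbij
  let c (t : ι) : G →* G := (Subgroup.subtype _).comp
    ((Pi.evalMonoidHom (fun t => Subgroup.zpowers (τ t)) t).comp e.symm.toMonoidHom)
  have hc (s t : ι) : c t (τ s) = if s = t then τ t else 1 := by
    have : e.symm (τ s) = Pi.mulSingle s ⟨τ s, Subgroup.mem_zpowers _⟩ := by
      rw [MulEquiv.symm_apply_eq]
      exact (Subgroup.noncommPiCoprod_mulSingle (hcomm := hcomm) s
        ⟨τ s, Subgroup.mem_zpowers _⟩).symm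
    change ((e.symm (τ s) t : Subgroup.zpowers (τ t)) : G) = _
    rw [this]
    split_ifs with hst
    · subst hst
      simp
    · simp [Pi.mulSingle_eq_of_ne (Ne.symm hst)]
  refine ⟨c, hc, fun t x => Subtype.prop _, fun x => ?_⟩
  have : ∏ t, c t = MonoidHom.id G := by
    refine monoidHom_ext_of_iSup_zpowers hgen fun s => ?_
    rw [MonoidHom.finsetProd_apply]
    simp [hc]
  rw [← MonoidHom.finsetProd_apply, this, MonoidHom.id_apply]

variable {c : ι → G →* G}

/-- A coordinate of an element of the subgroup generated by `a` and some of the `τ t` is the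
coordinate of a power of `a`. -/
lemma exists_coordinate_eq_of_mem_closure [DecidableEq ι]
    (hc : ∀ s t, c t (τ s) = if s = t then τ t else 1)
    {a : G} {S : Set ι} {x : G} (hx : x ∈ Subgroup.closure ({a} ∪ τ '' S)) :
    ∃ n : ℤ, ∀ t ∉ S, c t x = c t a ^ n := by
  rw [Subgroup.closure_union, ← Subgroup.zpowers_eq_closure] at hx
  obtain ⟨_, ⟨n, rfl⟩, y, hy, rfl⟩ := Subgroup.mem_sup.1 hx
  refine ⟨n, fun t ht => ?_⟩
  have : Subgroup.closure (τ '' S) ≤ (c t).ker := by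
    rw [Subgroup.closure_le]
    rintro _ ⟨s, hs, rfl⟩
    rw [SetLike.mem_coe, MonoidHom.mem_ker, hc, if_neg]
    rintro rfl
    exact ht hs
  simp [MonoidHom.mem_ker.1 (this hy)]

end Coordinates

/-- With `G` the internal direct product of the cyclic groups `⟨τ_1⟩, …, ⟨τ_m⟩` (orders
`g_1, …, g_{m-1}, g_m/ℓ^r`, all `g_i` powers of the prime `ℓ`, `ℓ^r ∣ g_m ≤ g_i`) and
`j = τ_1^{g_1/g_m} ⋯ τ_{m-1}^{g_{m-1}/g_m} τ_m`, write `P_i = {1,…,i}` and let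
`D_{P_i}` be the subgroup generated by `j, τ_{i+1}, …, τ_{m-1}`.  Then for `1 ≤ i ≤ m-2`
and `k ≥ 1` there is an isomorphism
`H^k(D_{P_{i+1}}, Λ/Λ(P_{i+1})) ≅ H^{k+1}(D_{P_i}, Λ/Λ(P_i))`. -/
theorem stmt_5 {G : Type} [CommGroup G] [Fintype G]
    (ℓ m r : ℕ) (hℓ : ℓ.Prime) (hm : 2 ≤ m)
    (τ : Fin m → G) (g : Fin m → ℕ)
    (lst : Fin m) (hlst : (lst : ℕ) = m - 1)
    (hpow : ∀ i, ∃ k, g i = ℓ ^ k)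
    (hdvd : ℓ ^ r ∣ g lst)
    (hle : ∀ i, g lst ≤ g i)
    (hord : ∀ i, i ≠ lst → orderOf (τ i) = g i)
    (hordlst : orderOf (τ lst) = g lst / ℓ ^ r)
    (hindep : iSupIndep fun i => Subgroup.zpowers (τ i))
    (hgen : (⨆ i, Subgroup.zpowers (τ i)) = ⊤)
    (j : G) (hj : j = ∏ i, τ i ^ (g i / g lst))
    (ΛP : ℕ → Ideal (MonoidAlgebra ℤ G))
    (hΛP : ∀ i : ℕ, ΛP i = Ideal.span
      ((fun t => sElt (Subgroup.zpowers (τ t))) '' {t : Fin m | (t : ℕ) < i}))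
    (D : ℕ → Subgroup G)
    (hD : ∀ i : ℕ, D i = Subgroup.closure
      ({j} ∪ τ '' {t : Fin m | i ≤ (t : ℕ) ∧ t ≠ lst})) :
    ∀ i : ℕ, 1 ≤ i → i ≤ m - 2 → ∀ k : ℕ, 1 ≤ k →
      Nonempty ((groupCohomology (Rep.of (quotRep (ΛP (i + 1)) (D (i + 1)))) k) ≃+
        (groupCohomology (Rep.of (quotRep (ΛP i) (D i))) (k + 1))) := by
  intro i hi him k hk
  obtain ⟨n, rfl⟩ := Nat.exists_eq_add_of_le' hk
  obtain ⟨c, hc, hcmem, hprod⟩ := exists_coordinates hindep hgen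
  have hcc (s t : Fin m) (x : G) (hx : x ∈ Subgroup.zpowers (τ s)) :
      c t x = if s = t then x else 1 := by
    obtain ⟨a, rfl⟩ := hx
    simp only [map_zpow, hc]
    split_ifs with hst <;> simp [hst]
  have hcj (t : Fin m) : c t j = τ t ^ (g t / g lst) := by
    simp [hj, map_prod, hc, ite_pow]
  have hpos (t : Fin m) : 0 < g t := by
    obtain ⟨a, ha⟩ := hpow t
    exact ha ▸ pow_pos hℓ.pos a
  have hdvd' (t : Fin m) : g lst ∣ g t := by
    have := hle t
    obtain ⟨a, ha⟩ := hpow t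
    obtain ⟨b, hb⟩ := hpow lst
    rw [ha, hb] at this ⊢
    exact pow_dvd_pow ℓ ((Nat.pow_le_pow_iff_right hℓ.one_lt).1 this)
  have hkey {t : Fin m} (ht : t ≠ lst) (a : ℤ) : c t j ^ a = 1 ↔ (g lst : ℤ) ∣ a := by
    obtain ⟨q, hq⟩ := hdvd' t
    have hq0 : (q : ℤ) ≠ 0 := by
      rintro h
      have := hpos t
      simp_all
    rw [hcj, ← zpow_natCast, ← zpow_mul, ← orderOf_dvd_iff_zpow_eq_one, hord t ht, hq,
      Nat.mul_div_cancel_left q (hpos lst), Nat.cast_mul, mul_comm (g lst : ℤ)]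
    exact mul_dvd_mul_iff_left hq0
  let i' : Fin m := ⟨i, by omega⟩
  have hi' : i' ≠ lst := fun h => by
    have : i = lst := congrArg Fin.val h
    omega
  let p : G →* G := MonoidHom.id G / c i'
  have hp (x : G) : p x = x / c i' x := rfl
  have hpfix {x : G} (hx : c i' x = 1) : p x = x := by rw [hp, hx, div_one]
  have hker : p.ker = Subgroup.zpowers (τ i') := by
    ext x
    rw [MonoidHom.mem_ker, hp, div_eq_one]
    refine ⟨fun h => h ▸ hcmem i' x, fun h => ?_⟩
    rw [hcc i' i' x h, if_pos rfl]
  let 𝓗 : Set (Subgroup G) := (fun t => Subgroup.zpowers (τ t)) '' {t : Fin m | (t : ℕ) < i}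
  have hcH {x : G} (hx : x ∈ sSup 𝓗) {t : Fin m} (ht : i ≤ (t : ℕ)) : c t x = 1 := by
    suffices sSup 𝓗 ≤ (c t).ker from MonoidHom.mem_ker.1 (this hx)
    refine sSup_le ?_
    rintro _ ⟨s, hs, rfl⟩ x hx
    rw [MonoidHom.mem_ker, hcc s t x hx, if_neg]
    rintro rfl
    exact absurd hs (not_lt.2 ht)
  have hcD {x : G} (hx : x ∈ D (i + 1)) :
      ∃ a : ℤ, ∀ t : Fin m, (t : ℕ) ≤ i → c t x = c t j ^ a := by
    rw [hD] at hx
    obtain ⟨a, ha⟩ := exists_coordinate_eq_of_mem_closure hc hx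
    exact ⟨a, fun t ht => ha t fun h => by have := h.1; omega⟩
  have hnl {t : Fin m} (ht : (t : ℕ) ≤ i) : t ≠ lst := by
    rintro rfl
    omega
  obtain ⟨e⟩ := nonempty_groupCohomology_quotRep_iso (p := p) (𝓗 := 𝓗) (I := ΛP i)
    (J := ΛP (i + 1)) (D := D i) (D' := D (i + 1))
    (fun x => hpfix (by rw [hp, map_div, hcc i' i' _ (hcmem i' x), if_pos rfl, div_self']))
    (fun H hH h hh => hpfix (hcH (le_sSup hH hh) le_rfl))
    (by rw [hΛP, Set.image_image])
    (by
      have : {t : Fin m | (t : ℕ) < i + 1} = insert i' {t : Fin m | (t : ℕ) < i} := by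
        ext t
        simp only [Set.mem_ofPred_eq, Set.mem_insert_iff, i', Fin.ext_iff]
        omega
      rw [hker, hΛP, hΛP, this, Set.image_insert_eq, Ideal.span_insert, sup_comm])
    (by
      have : {t : Fin m | i ≤ (t : ℕ) ∧ t ≠ lst} =
          insert i' {t : Fin m | i + 1 ≤ (t : ℕ) ∧ t ≠ lst} := by
        ext t
        simp only [Set.mem_ofPred_eq, Set.mem_insert_iff, i', Fin.ext_iff, ne_eq]
        omega
      rw [hker, hD, hD, this, Set.image_insert_eq, Set.union_insert, Set.insert_eq,
        Subgroup.closure_union {τ i'}, ← Subgroup.zpowers_eq_closure, sup_comm])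
    (by
      rw [hker, eq_bot_iff]
      intro x hx
      obtain ⟨hxD, hxN⟩ := Subgroup.mem_inf.1 hx
      obtain ⟨a, ha⟩ := hcD hxD
      let z : Fin m := ⟨0, by omega⟩
      have hz : c z j ^ a = 1 := by
        rw [← ha z (Nat.zero_le i), hcc i' z x hxN, if_neg]
        exact fun h => by
          have : i = 0 := congrArg Fin.val h
          omega
      have := (hkey hi' a).2 ((hkey (hnl (Nat.zero_le i)) a).1 hz)
      rwa [← ha i' le_rfl, hcc i' i' x hxN, if_pos rfl] at this)
    (by
      rw [eq_bot_iff]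
      intro x hx
      obtain ⟨hxH, hxD⟩ := Subgroup.mem_inf.1 hx
      obtain ⟨a, ha⟩ := hcD hxD
      have ha' : (g lst : ℤ) ∣ a := by
        rw [← hkey hi', ← ha i' le_rfl]
        exact hcH hxH le_rfl
      rw [Subgroup.mem_bot, ← hprod x]
      refine Finset.prod_eq_one fun t _ => ?_
      rcases lt_or_ge (t : ℕ) i with ht | ht
      · rw [ha t ht.le, (hkey (hnl ht.le) a).2 ha']
      · exact hcH hxH ht) n
  exact ⟨e.toLinearEquiv.toAddEquiv⟩
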